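/- In the abstract lake-kernel setup, suppose in addition that there is x̄ ∈ D with b(x̄) = max_{cl(D)} b, and there are r ∈ (0, dist(x̄,∂D)) and C₀ ≥ 0 such that G(x,y) ≥ (1/(2π))·ln(1/|x−y|) − C₀ for a.e. x,y ∈ B_r(x̄), and that b is Lipschitz continuous on B_r(x̄). Let f satisfy (H1) with lim_{s→∞} f(s) = +∞, let κ₀ > 0, Λ ≥ 1, and δ : (0,1) → (0,1). Then there exist C > 0 and ε₀ ∈ (0,1) such that for every ε ∈ (0,ε₀): sup_{ζ ∈ A_{ε,Λ}} E(ζ) ≥ (κ₀²·max_{cl(D)} b/(4π))·δ(ε)²·ln(1/ε) − C·δ(ε). -/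

import Mathlib

open MeasureTheory Metric Real Set Filter

noncomputable section

abbrev Pt : Type := EuclideanSpace ℝ (Fin 2)

/-- The operator `K` of the abstract lake-kernel setup:
`Kζ(x) = b(x)∫_D G(x,y)ζ(y) dν(y) + ∫_D R(x,y)ζ(y) dν(y)`, where `dν = b dm`. -/
def Kop (D : Set Pt) (b : Pt → ℝ) (G R : Pt → Pt → ℝ) (ζ : Pt → ℝ) (x : Pt) : ℝ :=
  b x * (∫ y in D, G x y * ζ y * b y) + ∫ y in D, R x y * ζ y * b y

/-- `F_*(s) = ∫₀^s f⁻¹(r) dr`. -/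
def Fstar (finv : ℝ → ℝ) (s : ℝ) : ℝ := ∫ r in (0:ℝ)..s, finv r

/-- The admissible class `A_{ε,Λ}`:
`0 ≤ ζ ≤ Λδ(ε)/ε²` a.e. in `D` and `∫_D ζ dν = κ₀ δ(ε)`. -/
def InA (D : Set Pt) (b : Pt → ℝ) (κ₀ ε δ Λ : ℝ) (ζ : Pt → ℝ) : Prop :=
  Measurable ζ ∧ (∀ᵐ x ∂(volume.restrict D), 0 ≤ ζ x ∧ ζ x ≤ Λ * δ / ε ^ 2) ∧
    (∫ x in D, ζ x * b x) = κ₀ * δ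

/-- The energy functional
`E(ζ) = (1/2)∫_D ζ·Kζ dν + ∫_D qζ dν − (δ/ε²)∫_D F_*((ε²/δ)ζ) dν`. -/
def Efun (D : Set Pt) (b q : Pt → ℝ) (G R : Pt → Pt → ℝ) (finv : ℝ → ℝ)
    (ε δ : ℝ) (ζ : Pt → ℝ) : ℝ :=
  (1/2) * (∫ x in D, ζ x * Kop D b G R ζ x * b x)
    + (∫ x in D, q x * ζ x * b x)
    - (δ / ε ^ 2) * ∫ x in D, Fstar finv ((ε ^ 2 / δ) * ζ x) * b x


lemma quad_lower (μ : Measure Pt) [IsFiniteMeasure μ] (b ζ : Pt → ℝ) (G R : Pt → Pt → ℝ)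
    (hG : Integrable (Function.uncurry G) (μ.prod μ))
    (hRm : Measurable (Function.uncurry R)) (CR : ℝ) (hCR : ∀ x y, |R x y| ≤ CR)
    (hbm : AEStronglyMeasurable b μ) (M : ℝ) (hbM : ∀ᵐ x ∂μ, |b x| ≤ M)
    (hζm : Measurable ζ) (Z : ℝ) (hZ : ∀ x, |ζ x| ≤ Z) (c : ℝ)
    (hlow : ∀ᵐ p ∂(μ.prod μ), c * ((ζ p.1 * b p.1) * (ζ p.2 * b p.2)) ≤
      (b p.1 * G p.1 p.2 + R p.1 p.2) * ((ζ p.1 * b p.1) * (ζ p.2 * b p.2))) :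
    c * (∫ x, ζ x * b x ∂μ) ^ 2 ≤
      ∫ x, ζ x * (b x * (∫ y, G x y * ζ y * b y ∂μ) + ∫ y, R x y * ζ y * b y ∂μ) * b x ∂μ := by
  have hM1 : ∀ᵐ p ∂(μ.prod μ), |b p.1| ≤ M := Measure.quasiMeasurePreserving_fst.ae hbM
  have hM2 : ∀ᵐ p ∂(μ.prod μ), |b p.2| ≤ M := Measure.quasiMeasurePreserving_snd.ae hbM
  have hb1 : AEStronglyMeasurable (fun p : Pt × Pt => b p.1) (μ.prod μ) := hbm.comp_fst
  have hb2 : AEStronglyMeasurable (fun p : Pt × Pt => b p.2) (μ.prod μ) := hbm.comp_snd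
  have hz1 : AEStronglyMeasurable (fun p : Pt × Pt => ζ p.1) (μ.prod μ) :=
    (hζm.comp measurable_fst).aestronglyMeasurable
  have hz2 : AEStronglyMeasurable (fun p : Pt × Pt => ζ p.2) (μ.prod μ) :=
    (hζm.comp measurable_snd).aestronglyMeasurable
  have hR : Integrable (Function.uncurry R) (μ.prod μ) :=
    Integrable.of_bound hRm.aestronglyMeasurable CR (Eventually.of_forall fun p => hCR p.1 p.2)
  have hw : Integrable (fun x => ζ x * b x) μ := by
    refine Integrable.of_bound (hζm.aestronglyMeasurable.mul hbm) (Z * M) ?_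
    filter_upwards [hbM] with x hx
    rw [norm_mul]
    exact mul_le_mul (hZ x) hx (abs_nonneg _) ((abs_nonneg _).trans (hZ x))
  have key : ∀ K : Pt → Pt → ℝ, Integrable (Function.uncurry K) (μ.prod μ) →
      Integrable (fun p : Pt × Pt => K p.1 p.2 * ζ p.2 * b p.2) (μ.prod μ) := by
    intro K hK
    have h1 : Integrable (fun p : Pt × Pt => ζ p.2 * K p.1 p.2) (μ.prod μ) :=
      hK.bdd_mul hz2 (Eventually.of_forall fun p => hZ p.2)
    have h2 := h1.bdd_mul hb2 hM2
    refine h2.congr (Eventually.of_forall fun p => ?_)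
    simp only; ring
  have hG2 := key G hG
  have hR2 := key R hR
  have hG3 : Integrable (fun p : Pt × Pt => b p.1 * (G p.1 p.2 * ζ p.2 * b p.2)) (μ.prod μ) :=
    hG2.bdd_mul hb1 hM1
  have hH : Integrable (fun p : Pt × Pt => (b p.1 * G p.1 p.2 + R p.1 p.2) *
      ((ζ p.1 * b p.1) * (ζ p.2 * b p.2))) (μ.prod μ) := by
    have h1 := ((hG3.add hR2).bdd_mul hz1 (Eventually.of_forall fun p => hZ p.1)).bdd_mul hb1 hM1
    refine h1.congr (Eventually.of_forall fun p => ?_)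
    simp only [Pi.add_apply]; ring
  have hE : ∫ x, ζ x * (b x * (∫ y, G x y * ζ y * b y ∂μ) + ∫ y, R x y * ζ y * b y ∂μ) * b x ∂μ
      = ∫ p, (b p.1 * G p.1 p.2 + R p.1 p.2) *
      ((ζ p.1 * b p.1) * (ζ p.2 * b p.2)) ∂(μ.prod μ) := by
    rw [integral_prod _ hH]
    refine integral_congr_ae ?_
    filter_upwards [hG2.prod_right_ae, hR2.prod_right_ae] with x h1 h2
    rw [← integral_const_mul, ← integral_add (h1.const_mul _) h2, ← integral_const_mul,
      ← integral_mul_const]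
    refine integral_congr_ae (Eventually.of_forall fun y => ?_)
    simp only; ring
  rw [hE, sq, ← integral_prod_mul, ← integral_const_mul]
  exact integral_mono_ae ((hw.mul_prod hw).const_mul c) hH hlow

lemma int_kernel (d : ℝ) :
    Integrable (fun x : Pt => (Set.Ioo (0:ℝ) d).indicator (fun t => t⁻¹) ‖x‖) volume := by
  have h := integrable_fun_norm_addHaar (E := Pt) (F := ℝ) volume
    (f := (Set.Ioo (0:ℝ) d).indicator (fun t => t⁻¹))
  rw [h]
  have hd : Module.finrank ℝ Pt = 2 := by simp [Pt]
  rw [hd]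
  have : IntegrableOn ((Set.Ioo (0:ℝ) d).indicator (fun _ => (1:ℝ))) (Ioi 0) := by
    refine Integrable.integrableOn ?_
    rw [integrable_indicator_iff measurableSet_Ioo]
    exact integrableOn_const (by simp)
  refine this.congr_fun ?_ measurableSet_Ioi
  intro t ht
  have : t ≠ 0 := ne_of_gt ht
  by_cases h : t ∈ Ioo 0 d <;> simp [h, this]

lemma G_integrable (D : Set Pt) (hDo : IsOpen D) (hDbdd : Bornology.IsBounded D)
    (G : Pt → Pt → ℝ) (hGm : Measurable (Function.uncurry G))
    (hGbd : ∀ᵐ p ∂((volume.restrict D).prod (volume.restrict D)),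
      0 ≤ G p.1 p.2 ∧ G p.1 p.2 ≤ (1 / (2 * π)) * log (diam D / dist p.1 p.2)) :
    Integrable (Function.uncurry G) ((volume.restrict D).prod (volume.restrict D)) := by
  have hDm := hDo.measurableSet
  have h1 : Integrable (D.indicator (fun _ => (1:ℝ))) (volume : Measure Pt) := by
    rw [integrable_indicator_iff hDm]
    exact integrableOn_const hDbdd.measure_lt_top.ne
  have h2 := h1.convolution_integrand (ContinuousLinearMap.mul ℝ ℝ) (int_kernel (diam D + 1))
  have h3 := (h2.const_mul ((1 / (2 * π)) * diam D)).restrict (s := D ×ˢ D)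
  rw [Measure.prod_restrict] at *
  refine h3.mono' hGm.aestronglyMeasurable ?_
  filter_upwards [hGbd, ae_restrict_mem (hDm.prod hDm)] with p hp hpD
  rw [Real.norm_eq_abs]
  simp only [Function.uncurry, ContinuousLinearMap.mul_apply']
  rw [abs_of_nonneg hp.1, Set.indicator_of_mem hpD.2]
  have hpi : 0 < 1 / (2 * π) := by positivity
  rcases eq_or_ne p.1 p.2 with h | h
  · have := hp.2
    rw [h, dist_self, div_zero, log_zero, mul_zero] at this
    simp [h] at this ⊢
    exact this
  · have hd : 0 < dist p.1 p.2 := dist_pos.2 h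
    have hd2 : dist p.1 p.2 ≤ diam D := dist_le_diam_of_mem hDbdd hpD.1 hpD.2
    rw [← dist_eq_norm, Set.indicator_of_mem (show dist p.1 p.2 ∈ Ioo 0 (diam D + 1) from ⟨hd, by linarith⟩)]
    refine hp.2.trans ?_
    rw [one_mul, mul_assoc]
    refine mul_le_mul_of_nonneg_left ?_ hpi.le
    rw [← div_eq_mul_inv]
    have : 0 < diam D / dist p.1 p.2 := by apply div_pos <;> linarith
    linarith [Real.log_le_sub_one_of_pos this]

lemma diag_null (D : Set Pt) :
    ∀ᵐ p ∂((volume.restrict D).prod (volume.restrict D) : Measure (Pt × Pt)), p.1 ≠ p.2 := by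
  have hm : MeasurableSet {p : Pt × Pt | p.1 ≠ p.2} :=
    (measurableSet_eq_fun measurable_fst measurable_snd).compl
  rw [Measure.ae_prod_iff_ae_ae hm]
  refine Eventually.of_forall fun x => ?_
  refine ae_restrict_of_ae ?_
  rw [ae_iff]
  have : {y : Pt | ¬ (x ≠ y)} = {x} := by ext y; simp [eq_comm]
  simp only [this]
  simp

lemma ball_subset_dom (D : Set Pt) (hDo : IsOpen D) (xbar : Pt) (hxbarD : xbar ∈ D) (r : ℝ)
    (hr : 0 < r) (hr2 : r < infDist xbar (frontier D)) : ball xbar r ⊆ D := by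
  have hd : Disjoint (ball xbar r) (frontier D) := by
    rw [Set.disjoint_left]
    intro y hy hyf
    have := infDist_le_dist_of_mem (x := xbar) hyf
    rw [mem_ball, dist_comm] at hy
    linarith
  have hc : IsPreconnected (ball xbar r) := (convex_ball xbar r).isPreconnected
  refine hc.subset_of_closure_inter_subset hDo ⟨xbar, mem_ball_self hr, hxbarD⟩ ?_
  rintro y ⟨hy1, hy2⟩
  by_contra hn
  refine Set.disjoint_left.1 hd hy2 ?_
  rw [hDo.frontier_eq]
  exact ⟨hy1, hn⟩

lemma Fstar_bound (f : ℝ → ℝ) (f0 : ℝ)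
    (hfneg : ∀ s ≤ (0:ℝ), f s = 0)
    (hfmono : StrictMonoOn f (Ici (0:ℝ))) (hf0n : 0 ≤ f0)
    (hfinf : Tendsto f atTop atTop)
    (finv : ℝ → ℝ) (hfinv0 : ∀ s ≤ f0, finv s = 0)
    (hfinvr : ∀ t ≥ f0, f (finv t) = t) :
    ∃ S > (0:ℝ), ∀ c, 0 ≤ c → c ≤ 1 → |Fstar finv c| ≤ S * c := by
  obtain ⟨S, hS1, hS⟩ := ((hfinf.eventually_ge_atTop 1).and (eventually_gt_atTop 0)).exists
  refine ⟨S, hS, fun c hc0 hc1 => ?_⟩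
  have := intervalIntegral.norm_integral_le_of_norm_le_const (a := 0) (b := c) (C := S)
    (f := finv) (by
      intro t ht
      rw [uIoc_of_le hc0] at ht
      rcases le_or_gt t f0 with h | h
      · rw [hfinv0 t h]; simpa using hS.le
      · have h1 := hfinvr t h.le
        have h2 : 0 < finv t := by
          by_contra hn
          rw [hfneg _ (not_lt.1 hn)] at h1
          linarith [ht.1]
        rw [Real.norm_eq_abs, abs_of_pos h2]
        by_contra hn
        have := hfmono (mem_Ici.2 hS.le) (mem_Ici.2 h2.le) (not_le.1 hn)
        linarith [ht.2])
  simpa [Fstar, abs_of_nonneg hc0] using this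

set_option maxHeartbeats 4000000 in
/-- Interior case (a) of Lemma 3.2: if the depth `b` attains its maximum over
`cl(D)` at an interior point `x̄` near which `G` has the logarithmic lower
bound and `b` is Lipschitz, then for small `ε`
`sup_{A_{ε,Λ}} E ≥ (κ₀² max b/(4π)) δ(ε)² ln(1/ε) − C δ(ε)`. -/
theorem stmt14
    -- the domain
    (D : Set Pt) (hDo : IsOpen D) (hDne : D.Nonempty) (hDbdd : Bornology.IsBounded D)
    -- the depth function
    (b : Pt → ℝ) (hb : ContinuousOn b (closure D)) (hbpos : ∀ x ∈ D, 0 < b x)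
    -- the background stream function
    (q : Pt → ℝ) (hq : ContinuousOn q (closure D))
    -- the kernel G
    (G : Pt → Pt → ℝ) (hGm : Measurable (Function.uncurry G))
    (hGsymm : ∀ x y, G x y = G y x)
    (hGbd : ∀ᵐ p ∂((volume.restrict D).prod (volume.restrict D)),
      0 ≤ G p.1 p.2 ∧ G p.1 p.2 ≤ (1 / (2 * π)) * log (diam D / dist p.1 p.2))
    -- the correction kernel R
    (R : Pt → Pt → ℝ) (hRm : Measurable (Function.uncurry R))
    (hRsymm : ∀ x y, R x y = R y x) (CR : ℝ) (hCR : ∀ x y, |R x y| ≤ CR)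
    -- the nonlinearity f satisfying (H1) with f → ∞ at ∞, and its inverse finv
    (f : ℝ → ℝ) (f0 : ℝ)
    (hfc : ContinuousOn f ({(0:ℝ)}ᶜ)) (hfneg : ∀ s ≤ (0:ℝ), f s = 0)
    (hfmono : StrictMonoOn f (Ici (0:ℝ)))
    (hf0 : Tendsto f (nhdsWithin 0 (Ioi 0)) (nhds f0)) (hf0n : 0 ≤ f0)
    (hfinf : Tendsto f atTop atTop)
    (finv : ℝ → ℝ) (hfinv0 : ∀ s ≤ f0, finv s = 0)
    (hfinvl : ∀ s ≥ (0:ℝ), finv (f s) = s) (hfinvr : ∀ t ≥ f0, f (finv t) = t)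
    -- interior maximum point of b with local lower bound on G
    (xbar : Pt) (hxbarD : xbar ∈ D)
    (hxbarmax : ∀ x ∈ closure D, b x ≤ b xbar)
    (r : ℝ) (hr : 0 < r) (hr2 : r < infDist xbar (frontier D))
    (C₀ : ℝ) (hC₀ : 0 ≤ C₀)
    (hGlow : ∀ᵐ p ∂((volume.restrict (ball xbar r)).prod (volume.restrict (ball xbar r))),
      (1 / (2 * π)) * log (1 / dist p.1 p.2) - C₀ ≤ G p.1 p.2)
    (Lb : NNReal) (hblip : LipschitzOnWith Lb b (ball xbar r))
    -- the parameters
    (κ₀ Λ : ℝ) (hκ : 0 < κ₀) (hΛ : 1 ≤ Λ)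
    (δ : ℝ → ℝ) (hδ : ∀ ε ∈ Ioo (0:ℝ) 1, δ ε ∈ Ioo (0:ℝ) 1) :
    ∃ C > (0:ℝ), ∃ ε₀ ∈ Ioo (0:ℝ) 1, ∀ ε ∈ Ioo (0:ℝ) ε₀,
      ∃ ζ : Pt → ℝ, InA D b κ₀ ε (δ ε) Λ ζ ∧
        (κ₀ ^ 2 * b xbar / (4 * π)) * (δ ε) ^ 2 * log (1 / ε) - C * δ ε ≤
          Efun D b q G R finv ε (δ ε) ζ := by
  classical
  set M := b xbar with hMdef
  have hM : 0 < M := hbpos _ hxbarD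
  have hDm := hDo.measurableSet
  have hsub := ball_subset_dom D hDo xbar hxbarD r hr hr2
  obtain ⟨S, hS, hFS⟩ := Fstar_bound f f0 hfneg hfmono hf0n hfinf finv hfinv0 hfinvr
  have hcpt : IsCompact (closure D) := hDbdd.isCompact_closure
  obtain ⟨Q, hQ⟩ := hcpt.exists_bound_of_continuousOn hq
  have hQ0 : 0 ≤ Q := (norm_nonneg _).trans (hQ xbar (subset_closure hxbarD))
  have hCR0 : 0 ≤ CR := (abs_nonneg _).trans (hCR xbar xbar)
  have hπ := Real.pi_pos
  obtain ⟨s, hs, hsκ⟩ : ∃ s > (0:ℝ), M / 2 * (π * s ^ 2) = κ₀ := by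
    refine ⟨√(2 * κ₀ / (M * π)), by positivity, ?_⟩
    rw [Real.sq_sqrt (by positivity)]
    field_simp
  set P := 1 / (2 * π) with hP
  have hP0 : 0 < P := by positivity
  set a := |log (2 * s)| with ha
  have ha0 : 0 ≤ a := abs_nonneg _
  have hL0 : (0:ℝ) ≤ Lb := Lb.2
  set T := M * P * a + M * C₀ + Lb * s * P * (1 + a) + CR with hT
  have hT0 : 0 ≤ T := by positivity
  set ε₀ := min (1/2) (min (r / s) (min (M / (2 * (Lb * s + 1))) (exp (-(a + C₀ / P))))) with hε₀
  have hε₀pos : 0 < ε₀ := by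
    refine lt_min (by norm_num) (lt_min (by positivity) (lt_min (by positivity) (exp_pos _)))
  refine ⟨κ₀ ^ 2 * T / 2 + Q * κ₀ + S * κ₀ + 1, by positivity, ε₀, ⟨hε₀pos,
    lt_of_le_of_lt (min_le_left _ _) (by norm_num)⟩, ?_⟩
  rintro ε ⟨hε, hεlt⟩
  obtain ⟨he1, hεlt⟩ := lt_min_iff.1 hεlt
  obtain ⟨he2, hεlt⟩ := lt_min_iff.1 hεlt
  obtain ⟨he3, he4⟩ := lt_min_iff.1 hεlt
  obtain ⟨hδ0, hδ1⟩ := hδ ε ⟨hε, by linarith⟩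
  set d := δ ε with hd
  have hsε : s * ε < r := by rw [lt_div_iff₀ hs] at he2; linarith
  have hLε : Lb * s * ε ≤ M / 2 := by
    rw [lt_div_iff₀ (by positivity)] at he3; nlinarith
  set l := log (1 / ε) with hl
  have hl1 : a + C₀ / P ≤ l := by
    rw [hl, one_div, log_inv]
    have := (Real.log_lt_log hε he4).le
    rw [Real.log_exp] at this
    linarith
  have hεl : ε * l ≤ 1 := by
    have h1 : l ≤ 1 / ε := by
      have := Real.log_le_sub_one_of_pos (show 0 < 1 / ε by positivity)
      linarith
    calc ε * l ≤ ε * (1 / ε) := by gcongr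
      _ = 1 := by field_simp
  have hA0 : 0 ≤ P * (l - a) - C₀ := by
    have : P * (C₀ / P) = C₀ := by field_simp
    nlinarith
  set B := ball xbar (s * ε) with hB
  have hBr : B ⊆ ball xbar r := ball_subset_ball hsε.le
  have hBD : B ⊆ D := hBr.trans hsub
  have hBm : MeasurableSet B := measurableSet_ball
  have hsε0 : 0 < s * ε := by positivity
  have hbB : ∀ x ∈ B, M - Lb * s * ε ≤ b x := by
    intro x hx
    have h1 := hblip.dist_le_mul x (hBr hx) xbar (mem_ball_self hr)
    have h2 : dist x xbar < s * ε := hx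
    rw [Real.dist_eq] at h1
    have h3 := (abs_le.1 h1).1
    have h4 : (Lb:ℝ) * dist x xbar ≤ Lb * (s * ε) := by gcongr
    linarith
  have hbc : ContinuousOn b D := hb.mono subset_closure
  have hbm : AEStronglyMeasurable b (volume.restrict D) := hbc.aestronglyMeasurable hDm
  have hbM : ∀ x ∈ D, |b x| ≤ M := fun x hx => by
    rw [abs_of_pos (hbpos x hx)]; exact hxbarmax x (subset_closure hx)
  have : IsFiniteMeasure (volume.restrict D : Measure Pt) :=
    ⟨by simpa using hDbdd.measure_lt_top⟩
  have hbint : IntegrableOn b D volume :=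
    Integrable.of_bound hbm M (by
      filter_upwards [ae_restrict_mem hDm] with x hx using hbM x hx)
  have hbintB : IntegrableOn b B volume := hbint.mono_set hBD
  set nu := ∫ x in B, b x with hnu
  have hvol : (volume B).toReal = π * (s * ε) ^ 2 := by
    rw [hB, EuclideanSpace.volume_ball_fin_two]
    simp [ENNReal.toReal_ofReal, hsε0.le, mul_comm, hπ.le]
  have hnu1 : κ₀ * ε ^ 2 ≤ nu := by
    have h1 : ∫ x in B, M / 2 ≤ nu := by
      refine setIntegral_mono_on (integrableOn_const measure_ball_lt_top.ne) hbintB hBm ?_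
      intro x hx
      linarith [hbB x hx]
    rw [setIntegral_const, measureReal_def, hvol] at h1
    rw [← hsκ]
    calc _ = (π * (s * ε) ^ 2) • (M / 2) := by simp only [smul_eq_mul]; ring
      _ ≤ _ := h1
  have hnu0 : 0 < nu := lt_of_lt_of_le (by positivity) hnu1
  set c := κ₀ * ε ^ 2 / nu with hc
  have hc0 : 0 < c := by positivity
  have hc1 : c ≤ 1 := (div_le_one hnu0).2 hnu1
  set ζ : Pt → ℝ := B.indicator (fun _ => c * d / ε ^ 2) with hζ
  have hζm : Measurable ζ := measurable_const.indicator hBm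
  have hk0 : 0 < c * d / ε ^ 2 := by positivity
  have hζ0 : ∀ x, 0 ≤ ζ x := fun x => indicator_nonneg (fun _ _ => hk0.le) x
  have hζle : ∀ x, ζ x ≤ c * d / ε ^ 2 := fun x => by
    by_cases hx : x ∈ B <;> simp [hζ, hx, hk0.le]
  have hmass : ∫ x in D, ζ x * b x = κ₀ * d := by
    have h1 : (fun x => ζ x * b x) = B.indicator (fun x => c * d / ε ^ 2 * b x) := by
      ext x; by_cases hx : x ∈ B <;> simp [hζ, hx]
    rw [h1, setIntegral_indicator hBm, inter_eq_self_of_subset_right hBD, integral_const_mul,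
      ← hnu, hc]
    field_simp
  have hwint : Integrable (fun x => ζ x * b x) (volume.restrict D) := by
    refine hbint.bdd_mul (c := c * d / ε ^ 2) hζm.aestronglyMeasurable (Eventually.of_forall fun x => ?_)
    rw [Real.norm_eq_abs, abs_of_nonneg (hζ0 x)]; exact hζle x
  refine ⟨ζ, ⟨hζm, Eventually.of_forall fun x => ⟨hζ0 x, (hζle x).trans ?_⟩, hmass⟩, ?_⟩
  · gcongr; linarith
  -- the quadratic part
  have hGint := G_integrable D hDo hDbdd G hGm hGbd
  have hquad := quad_lower (volume.restrict D) b ζ G R hGint hRm CR hCR hbm M (by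
      filter_upwards [ae_restrict_mem hDm] with x hx using hbM x hx) hζm (c * d / ε ^ 2)
      (fun x => by rw [abs_of_nonneg (hζ0 x)]; exact hζle x) (M * P * l - T) (by
    have hGlow' : ∀ᵐ p ∂((volume.restrict D).prod (volume.restrict D) : Measure (Pt × Pt)),
        p ∈ B ×ˢ B → P * log (1 / dist p.1 p.2) - C₀ ≤ G p.1 p.2 := by
      rw [Measure.prod_restrict] at hGlow ⊢
      rw [ae_restrict_iff' (measurableSet_ball.prod measurableSet_ball)] at hGlow
      refine ae_restrict_of_ae ?_
      filter_upwards [hGlow] with p hp hpB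
      exact hp ⟨hBr hpB.1, hBr hpB.2⟩
    filter_upwards [hGlow', diag_null D] with p hp hne
    by_cases hpB : p.1 ∈ B ∧ p.2 ∈ B
    · have hG := hp hpB
      have hw : 0 ≤ (ζ p.1 * b p.1) * (ζ p.2 * b p.2) := by
        have := hbpos _ (hBD hpB.1)
        have := hbpos _ (hBD hpB.2)
        have := hζ0 p.1
        have := hζ0 p.2
        positivity
      refine mul_le_mul_of_nonneg_right ?_ hw
      have hdp : 0 < dist p.1 p.2 := dist_pos.2 hne
      have hd2 : dist p.1 p.2 ≤ 2 * s * ε := by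
        have h1 : dist p.1 xbar < s * ε := hpB.1
        have h2 : dist p.2 xbar < s * ε := hpB.2
        linarith [dist_triangle_right p.1 p.2 xbar]
      have hlog : l - a ≤ log (1 / dist p.1 p.2) := by
        have h1 := Real.log_le_log hdp hd2
        rw [Real.log_mul (by positivity) hε.ne'] at h1
        rw [hl, one_div, one_div, log_inv, log_inv]
        linarith [le_abs_self (log (2 * s))]
      have hG1 : P * (l - a) - C₀ ≤ G p.1 p.2 := by
        have := mul_le_mul_of_nonneg_left hlog hP0.le
        linarith
      have hR1 := (abs_le.1 (hCR p.1 p.2)).1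
      have hb1 := hbB _ hpB.1
      have hbp := hbpos _ (hBD hpB.1)
      have e1 : b p.1 * (P * (l - a) - C₀) ≤ b p.1 * G p.1 p.2 :=
        mul_le_mul_of_nonneg_left hG1 hbp.le
      have e2 : (M - Lb * s * ε) * (P * (l - a) - C₀) ≤ b p.1 * (P * (l - a) - C₀) :=
        mul_le_mul_of_nonneg_right hb1 hA0
      have e3 : Lb * s * ε * (P * (l - a) - C₀) ≤ Lb * s * P * (1 + a) := by
        have h1 : Lb * s * ε * (P * (l - a) - C₀) ≤ Lb * s * ε * (P * l) := by
          refine mul_le_mul_of_nonneg_left ?_ (by positivity)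
          nlinarith
        have h2 : (Lb * s * P) * (ε * l) ≤ (Lb * s * P) * (1 + a) := by
          refine mul_le_mul_of_nonneg_left ?_ (by positivity)
          linarith
        linarith
      rw [hT]
      linarith
    · have : ζ p.1 = 0 ∨ ζ p.2 = 0 := by
        rcases not_and_or.1 hpB with h | h
        · left; simp [hζ, h]
        · right; simp [hζ, h]
      rcases this with h | h <;> simp [h])
  rw [hmass] at hquad
  -- the q part
  have hqpart : |∫ x in D, q x * ζ x * b x| ≤ Q * (κ₀ * d) := by
    rw [← hmass, ← integral_const_mul, ← Real.norm_eq_abs]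
    refine norm_integral_le_of_norm_le (hwint.const_mul Q) ?_
    filter_upwards [ae_restrict_mem hDm] with x hx
    have h1 := hQ x (subset_closure hx)
    have h2 : 0 ≤ ζ x * b x := mul_nonneg (hζ0 x) (hbpos x hx).le
    rw [mul_assoc, norm_mul, Real.norm_of_nonneg h2]
    exact mul_le_mul_of_nonneg_right h1 h2
  -- the F part
  have hFpart : |∫ x in D, Fstar finv ((ε ^ 2 / d) * ζ x) * b x| ≤
      S * (ε ^ 2 / d) * (κ₀ * d) := by
    rw [← hmass, ← integral_const_mul, ← Real.norm_eq_abs]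
    refine norm_integral_le_of_norm_le (hwint.const_mul _) ?_
    filter_upwards [ae_restrict_mem hDm] with x hx
    have h1 : 0 ≤ ε ^ 2 / d * ζ x := mul_nonneg (by positivity) (hζ0 x)
    have h2 : ε ^ 2 / d * ζ x ≤ 1 := by
      calc ε ^ 2 / d * ζ x ≤ ε ^ 2 / d * (c * d / ε ^ 2) := by gcongr; exact hζle x
        _ = c := by field_simp
        _ ≤ 1 := hc1
    rw [norm_mul, Real.norm_of_nonneg (hbpos x hx).le]
    calc _ ≤ (S * (ε ^ 2 / d * ζ x)) * b x :=
          mul_le_mul_of_nonneg_right (hFS _ h1 h2) (hbpos x hx).le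
      _ = _ := by ring
  have hFpart2 : (d / ε ^ 2) * ∫ x in D, Fstar finv ((ε ^ 2 / d) * ζ x) * b x ≤ S * κ₀ * d := by
    calc _ ≤ (d / ε ^ 2) * (S * (ε ^ 2 / d) * (κ₀ * d)) :=
          mul_le_mul_of_nonneg_left ((le_abs_self _).trans hFpart) (by positivity)
      _ = _ := by field_simp
  have hq1 := (abs_le.1 hqpart).1
  have hmain : κ₀ ^ 2 * M / (4 * π) * d ^ 2 * l = 1 / 2 * (M * P * l * (κ₀ * d) ^ 2) := by
    rw [hP]; field_simp; ring
  have hTd : κ₀ ^ 2 * T / 2 * d ^ 2 ≤ κ₀ ^ 2 * T / 2 * d :=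
    mul_le_mul_of_nonneg_left (by nlinarith) (by positivity)
  unfold Efun
  simp only [Kop]
  rw [hmain]
  nlinarith [hquad, hq1, hFpart2, hTd, hδ0]
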